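/- arXiv:math/0511640 — 3 statements merged into one kernel-verified Lean document; each statement's English description precedes it below -/
import Mathlib

section
/- For every integer n ≥ 1, limsup_{ε → 0⁺} λ_{n,ε}(Ω) ≤ λ_n(Ω). -/
open MeasureTheory Real Filter

/-- The penalized infimum `λ_{n,ε}(Ω)` over smooth compactly supported test functions. -/
noncomputable def lambdaPen (N : ℕ) (Ω : Set (EuclideanSpace ℝ (Fin N))) (n : ℕ) (ε : ℝ) : ℝ :=
  sInf { r : ℝ | ∃ φ : EuclideanSpace ℝ (Fin N) → ℝ,
    ContDiff ℝ (⊤ : ℕ∞) φ ∧ HasCompactSupport φ ∧ tsupport φ ⊆ Ω ∧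
    r = (∫ x in Ω, ‖fderiv ℝ φ x‖ ^ (1 + ε)) + (n : ℝ) * ((∫ x in Ω, |φ x| ^ (1 + ε)) - 1) ^ 2 }


lemma tendsto_integral_rpow_aux {E : Type*} [TopologicalSpace E] [MeasurableSpace E]
    [OpensMeasurableSpace E] (μ : Measure E) [IsFiniteMeasure μ]
    (g : E → ℝ) (hg : Continuous g) (h0 : ∀ x, 0 ≤ g x) (M : ℝ) (hM : ∀ x, g x ≤ M) :
    Tendsto (fun ε : ℝ => ∫ x, g x ^ (1 + ε) ∂μ) (nhdsWithin 0 (Set.Ioi 0))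
      (nhds (∫ x, g x ^ (1 + (0 : ℝ)) ∂μ)) := by
  apply tendsto_integral_filter_of_dominated_convergence (fun _ => (1 + |M|) ^ (2 : ℝ))
  · filter_upwards [self_mem_nhdsWithin] with ε hε
    have hε' : (0 : ℝ) < ε := hε
    exact (hg.rpow_const (fun x => Or.inr (by linarith))).measurable.aestronglyMeasurable
  · filter_upwards [Ioo_mem_nhdsGT (show (0 : ℝ) < 1 by norm_num)] with ε hε
    refine Eventually.of_forall fun x => ?_
    rw [Real.norm_of_nonneg (Real.rpow_nonneg (h0 x) _)]
    have h1 : g x ≤ 1 + |M| := by linarith [hM x, le_abs_self M]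
    calc g x ^ (1 + ε) ≤ (1 + |M|) ^ (1 + ε) :=
          Real.rpow_le_rpow (h0 x) h1 (by linarith [hε.1])
      _ ≤ (1 + |M|) ^ (2 : ℝ) :=
          Real.rpow_le_rpow_of_exponent_le (by linarith [abs_nonneg M]) (by linarith [hε.2])
  · exact integrable_const _
  · refine Eventually.of_forall fun x => ?_
    have h : ContinuousAt (fun ε : ℝ => g x ^ (1 + ε)) 0 := by
      apply ContinuousAt.rpow continuousAt_const (by fun_prop)
      right; norm_num
    exact h.tendsto.mono_left nhdsWithin_le_nhds

theorem limsup_lambdaPen_le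
    (N : ℕ) (hN : 1 < N) (Ω : Set (EuclideanSpace ℝ (Fin N)))
    (hΩo : IsOpen Ω) (hΩb : Bornology.IsBounded Ω) (hΩne : Ω.Nonempty)
    (n : ℕ) (hn : 1 ≤ n) :
    Filter.limsup (fun ε : ℝ => lambdaPen N Ω n ε) (nhdsWithin 0 (Set.Ioi 0)) ≤
      lambdaPen N Ω n 0 := by
  have hnn : ∀ (ε : ℝ) (φ : EuclideanSpace ℝ (Fin N) → ℝ),
      0 ≤ (∫ x in Ω, ‖fderiv ℝ φ x‖ ^ (1 + ε))
        + (n : ℝ) * ((∫ x in Ω, |φ x| ^ (1 + ε)) - 1) ^ 2 := by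
    intro ε φ
    have : 0 ≤ ∫ x in Ω, ‖fderiv ℝ φ x‖ ^ (1 + ε) :=
      integral_nonneg fun x => Real.rpow_nonneg (norm_nonneg _) _
    positivity
  have : IsFiniteMeasure (volume.restrict Ω) := ⟨by
    rw [Measure.restrict_apply_univ]; exact hΩb.measure_lt_top⟩
  conv_rhs => unfold lambdaPen
  refine le_csInf ⟨_, 0, contDiff_const, HasCompactSupport.zero, by simp, rfl⟩ ?_
  rintro r ⟨φ, hφ, hc, hs, rfl⟩
  have hdc : Continuous (fderiv ℝ φ) := hφ.continuous_fderiv (by simp)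
  obtain ⟨M1, hM1⟩ := (hc.fderiv (𝕜 := ℝ)).exists_bound_of_continuous hdc
  obtain ⟨M2, hM2⟩ := hc.exists_bound_of_continuous hφ.continuous
  have t1 := tendsto_integral_rpow_aux (volume.restrict Ω) (fun x => ‖fderiv ℝ φ x‖) hdc.norm
    (fun x => norm_nonneg _) M1 hM1
  have t2 := tendsto_integral_rpow_aux (volume.restrict Ω) (fun x => |φ x|) hφ.continuous.abs
    (fun x => abs_nonneg _) M2 hM2
  have t := t1.add (((t2.sub_const 1).pow 2).const_mul (n : ℝ))
  rw [← t.limsup_eq]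
  refine limsup_le_limsup (Eventually.of_forall fun ε => ?_) ?_ t.isBoundedUnder_le
  · refine csInf_le ⟨0, ?_⟩ ⟨φ, hφ, hc, hs, rfl⟩
    rintro _ ⟨ψ, _, _, _, rfl⟩
    exact hnn ε ψ
  · refine IsBoundedUnder.isCoboundedUnder_le ⟨0, ?_⟩
    refine Filter.eventually_map.2 (Eventually.of_forall fun ε => ?_)
    apply Real.sInf_nonneg
    rintro _ ⟨ψ, _, _, _, rfl⟩
    exact hnn ε ψ
end

section
/- For every integer n ≥ 1, lim_{ε → 0⁺} λ_{n,ε}(Ω) = λ_n(Ω). -/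
open MeasureTheory Real Filter

/-- The penalized functional. -/
noncomputable def penI (N : ℕ) (Ω : Set (EuclideanSpace ℝ (Fin N))) (n : ℕ)
    (φ : EuclideanSpace ℝ (Fin N) → ℝ) (ε : ℝ) : ℝ :=
  (∫ x in Ω, ‖fderiv ℝ φ x‖ ^ (1 + ε)) + (n : ℝ) * ((∫ x in Ω, |φ x| ^ (1 + ε)) - 1) ^ 2

theorem penI_nonneg (N : ℕ) (Ω : Set (EuclideanSpace ℝ (Fin N))) (n : ℕ)
    (φ : EuclideanSpace ℝ (Fin N) → ℝ) (ε : ℝ) : 0 ≤ penI N Ω n φ ε := by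
  unfold penI
  have : 0 ≤ ∫ x in Ω, ‖fderiv ℝ φ x‖ ^ (1 + ε) :=
    integral_nonneg fun x => by positivity
  positivity

theorem lambdaPen_le (N : ℕ) (Ω : Set (EuclideanSpace ℝ (Fin N))) (n : ℕ)
    (φ : EuclideanSpace ℝ (Fin N) → ℝ) (ε : ℝ) (h1 : ContDiff ℝ (⊤ : ℕ∞) φ)
    (h2 : HasCompactSupport φ) (h3 : tsupport φ ⊆ Ω) :
    lambdaPen N Ω n ε ≤ penI N Ω n φ ε := by
  apply csInf_le
  · refine ⟨0, ?_⟩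
    rintro r ⟨ψ, _, _, _, rfl⟩
    exact penI_nonneg N Ω n ψ ε
  · exact ⟨φ, h1, h2, h3, rfl⟩

theorem le_lambdaPen (N : ℕ) (Ω : Set (EuclideanSpace ℝ (Fin N))) (n : ℕ) (ε c : ℝ)
    (h : ∀ φ : EuclideanSpace ℝ (Fin N) → ℝ, ContDiff ℝ (⊤ : ℕ∞) φ → HasCompactSupport φ →
      tsupport φ ⊆ Ω → c ≤ penI N Ω n φ ε) :
    c ≤ lambdaPen N Ω n ε := by
  apply le_csInf
  · refine ⟨_, fun _ => 0, contDiff_const, HasCompactSupport.zero, ?_, rfl⟩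
    simp [tsupport]
  · rintro r ⟨ψ, h1, h2, h3, rfl⟩
    exact h ψ h1 h2 h3

theorem tendsto_int_rpow {N : ℕ} {Ω : Set (EuclideanSpace ℝ (Fin N))}
    (hΩb : Bornology.IsBounded Ω) (g : EuclideanSpace ℝ (Fin N) → ℝ) (hg : Continuous g)
    (hs : HasCompactSupport g) (h0 : ∀ x, 0 ≤ g x) :
    Tendsto (fun ε : ℝ => ∫ x in Ω, g x ^ (1 + ε)) (nhdsWithin 0 (Set.Ioi 0))
      (nhds (∫ x in Ω, g x ^ (1 + (0:ℝ)))) := by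
  have hfin : IsFiniteMeasure (volume.restrict Ω) :=
    ⟨by simpa using hΩb.measure_lt_top⟩
  obtain ⟨M, hM⟩ := hg.bounded_above_of_compact_support hs
  have hev : ∀ᶠ ε : ℝ in nhdsWithin 0 (Set.Ioi 0), 0 < ε ∧ ε < 1 := by
    filter_upwards [Ioo_mem_nhdsGT (show (0:ℝ) < 1 by norm_num)] with ε h using h
  apply tendsto_integral_filter_of_dominated_convergence (fun _ => (1 + |M|) ^ (2:ℝ))
  · filter_upwards [hev] with ε h
    exact (hg.rpow_const fun x => Or.inr (by linarith)).aestronglyMeasurable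
  · filter_upwards [hev] with ε h
    refine Eventually.of_forall fun x => ?_
    have h1 : g x ≤ 1 + |M| := by
      have := hM x
      rw [Real.norm_eq_abs] at this
      have := le_abs_self (g x)
      have := le_abs_self M
      linarith
    rw [Real.norm_eq_abs, abs_of_nonneg (Real.rpow_nonneg (h0 x) _)]
    calc g x ^ (1 + ε) ≤ (1 + |M|) ^ (1 + ε) :=
          Real.rpow_le_rpow (h0 x) h1 (by linarith)
      _ ≤ (1 + |M|) ^ (2:ℝ) :=
          Real.rpow_le_rpow_of_exponent_le (by linarith [abs_nonneg M]) (by linarith)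
  · exact integrable_const _
  · refine Eventually.of_forall fun x => ?_
    have hc : ContinuousAt (fun ε : ℝ => g x ^ (1 + ε)) 0 := by
      apply ContinuousAt.rpow continuousAt_const (by fun_prop)
      right; norm_num
    exact hc.tendsto.mono_left nhdsWithin_le_nhds

theorem tendsto_penI {N : ℕ} {Ω : Set (EuclideanSpace ℝ (Fin N))}
    (hΩb : Bornology.IsBounded Ω) (n : ℕ) (φ : EuclideanSpace ℝ (Fin N) → ℝ)
    (h1 : ContDiff ℝ (⊤ : ℕ∞) φ) (h2 : HasCompactSupport φ) :
    Tendsto (fun ε : ℝ => penI N Ω n φ ε) (nhdsWithin 0 (Set.Ioi 0))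
      (nhds (penI N Ω n φ 0)) := by
  have ha := tendsto_int_rpow hΩb (fun x => ‖fderiv ℝ φ x‖)
    (h1.continuous_fderiv (by simp)).norm (h2.fderiv ℝ).norm (fun x => norm_nonneg _)
  have hb := tendsto_int_rpow hΩb (fun x => |φ x|) h1.continuous.abs h2.norm
    (fun x => abs_nonneg _)
  exact ha.add (((hb.sub_const 1).pow 2).const_mul _)

/-- Smooth approximation of `|t|^p`. -/
noncomputable def regF (p δ t : ℝ) : ℝ := (t ^ 2 + δ ^ 2) ^ (p / 2) - (δ ^ 2) ^ (p / 2)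

theorem regF_contDiff (p δ : ℝ) (hδ : 0 < δ) : ContDiff ℝ (⊤ : ℕ∞) (regF p δ) := by
  unfold regF
  refine ContDiff.sub (ContDiff.rpow_const_of_ne (by fun_prop) fun t => ?_) contDiff_const
  positivity

theorem regF_nonneg (p δ t : ℝ) (hp : 0 < p) : 0 ≤ regF p δ t := by
  unfold regF
  have := Real.rpow_le_rpow (sq_nonneg δ) (show δ ^ 2 ≤ t ^ 2 + δ ^ 2 by nlinarith [sq_nonneg t])
    (show 0 ≤ p / 2 by positivity)
  linarith

theorem sq_rpow_half (p t : ℝ) : (t ^ 2) ^ (p / 2) = |t| ^ p := by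
  rw [← sq_abs, ← Real.rpow_natCast, ← Real.rpow_mul (abs_nonneg t)]
  congr 1
  push_cast
  ring

theorem regF_le (p δ t : ℝ) (hp : 0 < p) (hp2 : p ≤ 2) : regF p δ t ≤ |t| ^ p := by
  unfold regF
  have := Real.rpow_add_le_add_rpow (sq_nonneg t) (sq_nonneg δ)
    (show 0 ≤ p / 2 by positivity) (show p / 2 ≤ 1 by linarith)
  rw [sq_rpow_half p t] at this
  linarith

theorem le_regF (p δ t : ℝ) (hp : 0 < p) : |t| ^ p - |δ| ^ p ≤ regF p δ t := by
  unfold regF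
  have := Real.rpow_le_rpow (sq_nonneg t) (show t ^ 2 ≤ t ^ 2 + δ ^ 2 by nlinarith [sq_nonneg δ])
    (show 0 ≤ p / 2 by positivity)
  rw [sq_rpow_half p t] at this
  rw [sq_rpow_half p δ]
  linarith

theorem regF_hasDerivAt (p δ t : ℝ) (hδ : 0 < δ) :
    HasDerivAt (regF p δ) (p * t * (t ^ 2 + δ ^ 2) ^ (p / 2 - 1)) t := by
  have h : HasDerivAt (fun t : ℝ => t ^ 2 + δ ^ 2) (2 * t) t := by
    simpa using (hasDerivAt_pow 2 t).add_const (δ ^ 2)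
  have h' := (h.rpow_const (p := p / 2) (Or.inl (by positivity))).sub_const ((δ ^ 2) ^ (p / 2))
  refine HasDerivAt.congr_deriv h' ?_
  ring

theorem regF_deriv_bound (p δ t : ℝ) (hδ : 0 < δ) (hp : 1 < p) (hp2 : p ≤ 2) :
    |p * t * (t ^ 2 + δ ^ 2) ^ (p / 2 - 1)| ≤ p * |t| ^ (p - 1) := by
  rcases eq_or_ne t 0 with rfl | ht
  · simp
    positivity
  have ht' : 0 < |t| := abs_pos.mpr ht
  have h1 : (t ^ 2 + δ ^ 2) ^ (p / 2 - 1) ≤ (t ^ 2) ^ (p / 2 - 1) :=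
    Real.rpow_le_rpow_of_nonpos (by positivity) (by nlinarith) (by linarith)
  have h2 : (t ^ 2) ^ (p / 2 - 1) = |t| ^ (p - 2) := by
    rw [← sq_rpow_half]; congr 1; ring
  rw [abs_mul, abs_mul, abs_of_pos (show 0 < p by linarith),
    abs_of_nonneg (Real.rpow_nonneg (by positivity) _), mul_assoc]
  rw [h2] at h1
  have h3 : |t| * |t| ^ (p - 2) = |t| ^ (p - 1) := by
    rw [← Real.rpow_one_add' ht'.le (by linarith)]; congr 1; ring
  rw [← h3]
  gcongr

theorem young_bound (p a b : ℝ) (hp : 1 < p) (ha : 0 ≤ a) (hb : 0 ≤ b) :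
    p * a ^ (p - 1) * b ≤ b ^ p + (p - 1) * a ^ p := by
  have hp0 : 0 < p := by linarith
  have h := Real.geom_mean_le_arith_mean2_weighted (w₁ := (p - 1) / p) (w₂ := 1 / p)
    (p₁ := a ^ p) (p₂ := b ^ p) (by apply div_nonneg <;> linarith) (by positivity)
    (Real.rpow_nonneg ha _) (Real.rpow_nonneg hb _) (by field_simp; ring)
  rw [← Real.rpow_mul ha, ← Real.rpow_mul hb, mul_div_cancel₀ _ hp0.ne',
    mul_one_div_cancel hp0.ne', Real.rpow_one] at h
  have h' := mul_le_mul_of_nonneg_left h hp0.le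
  have e : p * ((p - 1) / p * a ^ p + 1 / p * b ^ p) = b ^ p + (p - 1) * a ^ p := by
    field_simp; ring
  rw [e] at h'
  linarith

theorem integrable_rpow {N : ℕ} (Ω : Set (EuclideanSpace ℝ (Fin N)))
    (g : EuclideanSpace ℝ (Fin N) → ℝ) (hg : Continuous g)
    (hs : HasCompactSupport g) (p : ℝ) (hp : 0 < p) :
    IntegrableOn (fun x => g x ^ p) Ω := by
  have h1 : Continuous (fun x => g x ^ p) := hg.rpow_const fun x => Or.inr hp.le
  have h2 : HasCompactSupport (fun x => g x ^ p) :=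
    hs.comp_left (g := fun t : ℝ => t ^ p) (Real.zero_rpow hp.ne')
  exact (h1.integrable_of_hasCompactSupport h2).integrableOn

theorem lower_aux {N : ℕ} {Ω : Set (EuclideanSpace ℝ (Fin N))}
    (hΩb : Bornology.IsBounded Ω) (n : ℕ) (φ : EuclideanSpace ℝ (Fin N) → ℝ)
    (h1 : ContDiff ℝ (⊤ : ℕ∞) φ) (h2 : HasCompactSupport φ) (h3 : tsupport φ ⊆ Ω)
    (ε : ℝ) (hε : 0 < ε) (hε1 : ε < 1) :
    lambdaPen N Ω n 0 ≤ penI N Ω n φ ε + ε * ∫ x in Ω, |φ x| ^ (1 + ε) := by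
  have hfin : IsFiniteMeasure (volume.restrict Ω) :=
    ⟨by simpa using hΩb.measure_lt_top⟩
  set p := 1 + ε with hp
  have hA : IntegrableOn (fun x => |φ x| ^ p) Ω :=
    integrable_rpow Ω _ h1.continuous.abs h2.norm p (by linarith)
  have hG : IntegrableOn (fun x => ‖fderiv ℝ φ x‖ ^ p) Ω :=
    integrable_rpow Ω _ (h1.continuous_fderiv (by simp)).norm (h2.fderiv ℝ).norm p (by linarith)
  set A := ∫ x in Ω, |φ x| ^ p with hAdef
  set G := ∫ x in Ω, ‖fderiv ℝ φ x‖ ^ p with hGdef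
  have hF0 : ∀ δ, regF p δ 0 = 0 := fun δ => by simp [regF]
  have hcs : ∀ δ, HasCompactSupport (fun x => regF p δ (φ x)) := fun δ =>
    h2.comp_left (g := regF p δ) (hF0 δ)
  have hcd : ∀ δ, 0 < δ → ContDiff ℝ (⊤ : ℕ∞) (fun x => regF p δ (φ x)) := fun δ hδ =>
    (regF_contDiff p δ hδ).comp h1
  have hB : ∀ δ, 0 < δ → IntegrableOn (fun x => regF p δ (φ x)) Ω := fun δ hδ =>
    ((hcd δ hδ).continuous.integrable_of_hasCompactSupport (hcs δ)).integrableOn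
  -- main inequality for each `δ`
  have key : ∀ δ, 0 < δ → lambdaPen N Ω n 0 ≤
      (G + ε * A) + n * ((∫ x in Ω, regF p δ (φ x)) - 1) ^ 2 := by
    intro δ hδ
    have hsub : tsupport (fun x => regF p δ (φ x)) ⊆ Ω :=
      (closure_mono (Function.support_comp_subset (hF0 δ) φ)).trans h3
    refine (lambdaPen_le N Ω n _ 0 (hcd δ hδ) (hcs δ) hsub).trans ?_
    unfold penI
    simp only [add_zero, Real.rpow_one]
    have e : ∀ x, |regF p δ (φ x)| = regF p δ (φ x) := fun x =>
      abs_of_nonneg (regF_nonneg p δ _ (by linarith))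
    simp only [e]
    gcongr
    have hsum : ∫ x in Ω, (‖fderiv ℝ φ x‖ ^ p + ε * |φ x| ^ p) = G + ε * A := by
      rw [integral_add hG (hA.const_mul ε), integral_const_mul]
    rw [← hsum]
    refine integral_mono
      ((((hcd δ hδ).continuous_fderiv (by simp)).norm.integrable_of_hasCompactSupport
        ((hcs δ).fderiv ℝ).norm).integrableOn) (hG.add (hA.const_mul ε)) fun x => ?_
    have hd : HasFDerivAt φ (fderiv ℝ φ x) x :=
      (h1.differentiable (by simp) x).hasFDerivAt
    have hd2 := (regF_hasDerivAt p δ (φ x) hδ).comp_hasFDerivAt x hd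
    have hd3 : fderiv ℝ (fun x => regF p δ (φ x)) x = _ := hd2.fderiv
    simp only [hd3, norm_smul, Real.norm_eq_abs]
    calc _ ≤ p * |φ x| ^ (p - 1) * ‖fderiv ℝ φ x‖ := by
          gcongr
          exact regF_deriv_bound p δ (φ x) hδ (by linarith) (by linarith)
      _ ≤ ‖fderiv ℝ φ x‖ ^ p + (p - 1) * |φ x| ^ p :=
          young_bound p _ _ (by linarith) (abs_nonneg _) (norm_nonneg _)
      _ = _ := by rw [hp]; ring
  have hlim : Tendsto (fun δ : ℝ => ∫ x in Ω, regF p δ (φ x)) (nhdsWithin 0 (Set.Ioi 0))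
      (nhds A) := by
    have hlow : Tendsto (fun δ : ℝ => A - |δ| ^ p * volume.real Ω) (nhdsWithin 0 (Set.Ioi 0))
        (nhds A) := by
      have hc : Continuous (fun δ : ℝ => A - |δ| ^ p * volume.real Ω) := by
        have : Continuous (fun δ : ℝ => |δ| ^ p) :=
          continuous_abs.rpow_const fun x => Or.inr (by linarith)
        fun_prop
      have := (hc.tendsto 0).mono_left (nhdsWithin_le_nhds (s := Set.Ioi 0))
      simpa [Real.zero_rpow (show p ≠ 0 by linarith)] using this
    refine tendsto_of_tendsto_of_tendsto_of_le_of_le' hlow tendsto_const_nhds ?_ ?_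
    · filter_upwards [self_mem_nhdsWithin] with δ hδ
      have : ∫ x in Ω, (|φ x| ^ p - |δ| ^ p) = A - |δ| ^ p * volume.real Ω := by
        rw [integral_sub hA (integrable_const _)]
        simp [mul_comm, hAdef]
      rw [← this]
      exact integral_mono (hA.sub (integrable_const _)) (hB δ hδ)
        fun x => le_regF p δ _ (by linarith)
    · filter_upwards [self_mem_nhdsWithin] with δ hδ
      exact integral_mono (hB δ hδ) hA fun x => regF_le p δ _ (by linarith) (by linarith)
  have hfinal := ge_of_tendsto ((((hlim.sub_const 1).pow 2).const_mul (n:ℝ)).const_add (G + ε * A))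
    (by filter_upwards [self_mem_nhdsWithin] with δ hδ using key δ hδ)
  unfold penI
  rw [← hp, ← hAdef, ← hGdef]
  linarith

theorem lower_bound {N : ℕ} {Ω : Set (EuclideanSpace ℝ (Fin N))}
    (hΩb : Bornology.IsBounded Ω) (n : ℕ) (hn : 1 ≤ n)
    (ε : ℝ) (hε : 0 < ε) (hε1 : ε < 1) :
    (lambdaPen N Ω n 0 - 2 * ε) / (1 + ε) ≤ lambdaPen N Ω n ε := by
  apply le_lambdaPen
  intro φ h1 h2 h3
  have h := lower_aux hΩb n φ h1 h2 h3 ε hε hε1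
  rw [div_le_iff₀ (by linarith)]
  have hA : (∫ x in Ω, |φ x| ^ (1 + ε)) ≤ 2 + penI N Ω n φ ε := by
    have hG : 0 ≤ ∫ x in Ω, ‖fderiv ℝ φ x‖ ^ (1 + ε) :=
      integral_nonneg fun x => by positivity
    have hn' : (1:ℝ) ≤ n := by exact_mod_cast hn
    unfold penI
    set A := ∫ x in Ω, |φ x| ^ (1 + ε)
    nlinarith [mul_le_mul_of_nonneg_right hn' (sq_nonneg (A - 1)), sq_nonneg (A - 1 - 1)]
  nlinarith [mul_le_mul_of_nonneg_left hA hε.le]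

theorem tendsto_lambdaPen
    (N : ℕ) (hN : 1 < N) (Ω : Set (EuclideanSpace ℝ (Fin N)))
    (hΩo : IsOpen Ω) (hΩb : Bornology.IsBounded Ω) (hΩne : Ω.Nonempty)
    (n : ℕ) (hn : 1 ≤ n) :
    Tendsto (fun ε : ℝ => lambdaPen N Ω n ε) (nhdsWithin 0 (Set.Ioi 0))
      (nhds (lambdaPen N Ω n 0)) := by
  have hev : ∀ᶠ ε : ℝ in nhdsWithin 0 (Set.Ioi 0), 0 < ε ∧ ε < 1 := by
    filter_upwards [Ioo_mem_nhdsGT (show (0:ℝ) < 1 by norm_num)] with ε h using h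
  rw [tendsto_order]
  constructor
  · intro a ha
    have hc : ContinuousAt (fun ε : ℝ => (lambdaPen N Ω n 0 - 2 * ε) / (1 + ε)) 0 :=
      ContinuousAt.div (by fun_prop) (by fun_prop) (by norm_num)
    have ht := hc.tendsto.mono_left (nhdsWithin_le_nhds (s := Set.Ioi 0))
    simp only [mul_zero, sub_zero, add_zero, div_one] at ht
    filter_upwards [hev, ht.eventually_const_lt ha] with ε h h'
    exact h'.trans_le (lower_bound hΩb n hn ε h.1 h.2)
  · intro a ha
    by_contra hcon
    have : a ≤ lambdaPen N Ω n 0 := by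
      apply le_lambdaPen
      intro φ h1 h2 h3
      by_contra! hlt
      apply hcon
      filter_upwards [(tendsto_penI hΩb n φ h1 h2).eventually_lt_const hlt] with ε h
      exact (lambdaPen_le N Ω n φ ε h1 h2 h3).trans_lt h
    linarith
end

section
/- The sequence of penalized infima converges to the first eigenvalue of the 1-Laplacian: lim_{n → ∞} λ_n(Ω) = Λ₁(Ω). -/
open MeasureTheory Real Filter

/-- The penalized infimum `λ_n(Ω)` over smooth compactly supported test functions. -/
noncomputable def lambdaN (N : ℕ) (Ω : Set (EuclideanSpace ℝ (Fin N))) (n : ℕ) : ℝ :=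
  sInf { r : ℝ | ∃ φ : EuclideanSpace ℝ (Fin N) → ℝ,
    ContDiff ℝ (⊤ : ℕ∞) φ ∧ HasCompactSupport φ ∧ tsupport φ ⊆ Ω ∧
    r = (∫ x in Ω, ‖fderiv ℝ φ x‖) + (n : ℝ) * ((∫ x in Ω, |φ x|) - 1) ^ 2 }

/-- The first eigenvalue `Λ₁(Ω)` of the 1-Laplacian. -/
noncomputable def lambdaOne (N : ℕ) (Ω : Set (EuclideanSpace ℝ (Fin N))) : ℝ :=
  sInf { r : ℝ | ∃ φ : EuclideanSpace ℝ (Fin N) → ℝ,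
    ContDiff ℝ (⊤ : ℕ∞) φ ∧ HasCompactSupport φ ∧ tsupport φ ⊆ Ω ∧
    (∫ x in Ω, |φ x|) = 1 ∧ r = ∫ x in Ω, ‖fderiv ℝ φ x‖ }

lemma lambdaOne_bddBelow (N : ℕ) (Ω : Set (EuclideanSpace ℝ (Fin N))) :
    BddBelow { r : ℝ | ∃ φ : EuclideanSpace ℝ (Fin N) → ℝ,
    ContDiff ℝ (⊤ : ℕ∞) φ ∧ HasCompactSupport φ ∧ tsupport φ ⊆ Ω ∧
    (∫ x in Ω, |φ x|) = 1 ∧ r = ∫ x in Ω, ‖fderiv ℝ φ x‖ } := by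
  refine ⟨0, ?_⟩
  rintro r ⟨φ, -, -, -, -, rfl⟩
  exact integral_nonneg fun x => norm_nonneg _

/-- Normalising a test function. -/
lemma scaled_mem (N : ℕ) (Ω : Set (EuclideanSpace ℝ (Fin N)))
    (φ : EuclideanSpace ℝ (Fin N) → ℝ) (h1 : ContDiff ℝ (⊤ : ℕ∞) φ) (h2 : HasCompactSupport φ)
    (h3 : tsupport φ ⊆ Ω) (ha : 0 < ∫ x in Ω, |φ x|) :
    (∫ x in Ω, |φ x|)⁻¹ * (∫ x in Ω, ‖fderiv ℝ φ x‖) ∈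
      { r : ℝ | ∃ φ : EuclideanSpace ℝ (Fin N) → ℝ,
    ContDiff ℝ (⊤ : ℕ∞) φ ∧ HasCompactSupport φ ∧ tsupport φ ⊆ Ω ∧
    (∫ x in Ω, |φ x|) = 1 ∧ r = ∫ x in Ω, ‖fderiv ℝ φ x‖ } := by
  set a := ∫ x in Ω, |φ x| with hadef
  refine ⟨fun x => a⁻¹ * φ x, contDiff_const.mul h1, h2.mul_left,
    (tsupport_mul_subset_right (f := fun _ => a⁻¹) (g := φ)).trans h3, ?_, ?_⟩
  · simp_rw [abs_mul]
    rw [integral_const_mul, ← hadef, abs_of_pos (inv_pos.2 ha), inv_mul_cancel₀ ha.ne']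
  · rw [← integral_const_mul]
    congr 1
    ext x
    rw [fderiv_const_mul (h1.differentiable (by simp) x), norm_smul, Real.norm_eq_abs,
      abs_of_pos (inv_pos.2 ha)]

lemma lambdaOne_nonempty (N : ℕ) (Ω : Set (EuclideanSpace ℝ (Fin N)))
    (hΩo : IsOpen Ω) (hΩne : Ω.Nonempty) :
    { r : ℝ | ∃ φ : EuclideanSpace ℝ (Fin N) → ℝ,
    ContDiff ℝ (⊤ : ℕ∞) φ ∧ HasCompactSupport φ ∧ tsupport φ ⊆ Ω ∧
    (∫ x in Ω, |φ x|) = 1 ∧ r = ∫ x in Ω, ‖fderiv ℝ φ x‖ }.Nonempty := by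
  obtain ⟨x, hx⟩ := hΩne
  obtain ⟨φ, h3, h2, h1, hr, hφx⟩ := exists_contDiff_tsupport_subset (n := (⊤ : ℕ∞))
    (hΩo.mem_nhds hx)
  refine ⟨_, scaled_mem N Ω φ h1 h2 h3 ?_⟩
  have hsup : Function.support (fun y => |φ y|) ⊆ Ω := by
    intro y hy
    apply h3
    apply subset_tsupport
    simpa using hy
  rw [setIntegral_eq_integral_of_forall_compl_eq_zero
    (fun y hy => by by_contra h; exact hy (hsup h))]
  exact h1.continuous.abs.integral_pos_of_hasCompactSupport_nonneg_nonzero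
    (h2.comp_left (g := fun t : ℝ => |t|) abs_zero) (fun y => abs_nonneg _) (x := x)
    (by simp [hφx])

theorem tendsto_lambdaN_lambdaOne
    (N : ℕ) (hN : 1 < N) (Ω : Set (EuclideanSpace ℝ (Fin N)))
    (hΩo : IsOpen Ω) (hΩb : Bornology.IsBounded Ω) (hΩne : Ω.Nonempty) :
    Tendsto (fun n : ℕ => lambdaN N Ω n) atTop (nhds (lambdaOne N Ω)) := by
  have hne := lambdaOne_nonempty N Ω hΩo hΩne
  have hlow : Tendsto (fun n : ℕ => lambdaOne N Ω - (lambdaOne N Ω ^ 2 / 4) / (n : ℝ)) atTop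
      (nhds (lambdaOne N Ω)) := by
    simpa using (tendsto_const_nhds (x := lambdaOne N Ω)).sub
      (tendsto_const_div_atTop_nhds_zero_nat (lambdaOne N Ω ^ 2 / 4))
  refine tendsto_of_tendsto_of_tendsto_of_le_of_le' hlow tendsto_const_nhds ?_ ?_
  · filter_upwards [eventually_gt_atTop 0] with n hn
    have hn' : (0 : ℝ) < n := by exact_mod_cast hn
    apply le_csInf
    · exact ⟨_, fun _ => 0, contDiff_const, HasCompactSupport.zero, by simp [tsupport], rfl⟩
    · rintro r ⟨φ, h1, h2, h3, rfl⟩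
      have key : lambdaOne N Ω * (∫ x in Ω, |φ x|) ≤ ∫ x in Ω, ‖fderiv ℝ φ x‖ := by
        have h0 : 0 ≤ ∫ x in Ω, |φ x| := integral_nonneg fun x => abs_nonneg _
        rcases h0.eq_or_lt with h | h
        · rw [← h, mul_zero]
          exact integral_nonneg fun x => norm_nonneg _
        · have := csInf_le (lambdaOne_bddBelow N Ω) (scaled_mem N Ω φ h1 h2 h3 h)
          rw [← le_div_iff₀ h, div_eq_inv_mul]
          exact this
      generalize (∫ x in Ω, |φ x|) = a at key ⊢
      generalize (∫ x in Ω, ‖fderiv ℝ φ x‖) = G at key ⊢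
      generalize lambdaOne N Ω = L at key ⊢
      have h : L * a + n * (a - 1) ^ 2 - (L - (L ^ 2 / 4) / n) = (n * (a - 1) + L / 2) ^ 2 / n := by
        field_simp
        ring
      have h' : 0 ≤ (n * (a - 1) + L / 2) ^ 2 / n := by positivity
      linarith
  · refine Eventually.of_forall fun n => ?_
    apply csInf_le_csInf _ hne
    · rintro r ⟨φ, h1, h2, h3, h4, rfl⟩
      exact ⟨φ, h1, h2, h3, by simp [h4]⟩
    · refine ⟨0, ?_⟩
      rintro r ⟨φ, -, -, -, rfl⟩
      have : 0 ≤ ∫ x in Ω, ‖fderiv ℝ φ x‖ := integral_nonneg fun x => norm_nonneg _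
      positivity
end
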